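/- arXiv:2509.06334 — 5 statements merged into one kernel-verified Lean document; each statement's English description precedes it below -/
import Mathlib

section
/- Define h(θ) = (1/(2π))·log((1 + sin θ)/(1 - sin θ)) + (1 - θ/π)·(1/cos θ + π·(tan θ + π - 2θ + 3)/(4(π - θ))) for θ ∈ (0, π/2). Then h is strictly monotone increasing on the interval [1.148, π/2); in particular h(θ) ≥ h(1.148) for all θ ∈ [1.148, π/2). -/
open Real

/-- The cost function with the factor `π - θ` cancelled and the logarithm split. -/
noncomputable def simplifiedCost (θ : ℝ) : ℝ :=
  1 / (2 * π) * (log (1 + sin θ) - log (1 - sin θ)) + (1 - θ / π) * (cos θ)⁻¹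
    + (tan θ + π - 2 * θ + 3) / 4

lemma sin_lt_one_of_cos_pos {θ : ℝ} (hc : 0 < cos θ) : sin θ < 1 := by
  nlinarith [sin_sq_add_cos_sq θ]

lemma neg_one_lt_sin_of_cos_pos {θ : ℝ} (hc : 0 < cos θ) : -1 < sin θ := by
  nlinarith [sin_sq_add_cos_sq θ]

lemma simplifiedCost_eq {θ : ℝ} (hc : 0 < cos θ) (hθ : θ < π) :
    (1 / (2 * π)) * log ((1 + sin θ) / (1 - sin θ))
      + (1 - θ / π) * (1 / cos θ + π * (tan θ + π - 2 * θ + 3) / (4 * (π - θ)))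
    = simplifiedCost θ := by
  have h₁ := sin_lt_one_of_cos_pos hc
  have h₂ := neg_one_lt_sin_of_cos_pos hc
  have h₃ : π - θ ≠ 0 := by linarith
  have h₄ := pi_ne_zero
  rw [simplifiedCost, log_div (by linarith) (by linarith)]
  field_simp
  ring

lemma hasDerivAt_simplifiedCost {θ : ℝ} (hc : 0 < cos θ) :
    HasDerivAt simplifiedCost
      ((1 - θ / π) * (sin θ / cos θ ^ 2) + (1 / cos θ ^ 2 - 2) / 4) θ := by
  have h₁ : 1 - sin θ ≠ 0 := by linarith [sin_lt_one_of_cos_pos hc]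
  have h₂ : 1 + sin θ ≠ 0 := by linarith [neg_one_lt_sin_of_cos_pos hc]
  have hlog := ((((hasDerivAt_sin θ).const_add 1).log h₂).sub
    (((hasDerivAt_sin θ).const_sub 1).log h₁)).const_mul (1 / (2 * π))
  have hinv := (((hasDerivAt_id θ).div_const π).const_sub 1).mul
    ((hasDerivAt_cos θ).fun_inv hc.ne')
  have htan := (((((hasDerivAt_tan hc.ne').add_const π).sub
    ((hasDerivAt_id θ).const_mul 2)).add_const 3).div_const 4)
  have hsec : cos θ / (1 + sin θ) - -cos θ / (1 - sin θ) = 2 * (cos θ)⁻¹ := by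
    field_simp
    linear_combination 2 * sin_sq_add_cos_sq θ
  refine ((hlog.add hinv).add htan).congr_deriv ?_
  rw [hsec]
  simp only [id]
  field_simp
  ring

lemma simplifiedCost_strictMonoOn :
    StrictMonoOn simplifiedCost (Set.Ioo (π / 4) (π / 2)) := by
  have hcos : ∀ θ ∈ Set.Ioo (π / 4) (π / 2), 0 < cos θ := fun θ hθ ↦
    cos_pos_of_mem_Ioo ⟨by linarith [hθ.1, pi_pos], hθ.2⟩
  refine strictMonoOn_of_hasDerivWithinAt_pos (convex_Ioo _ _)
    (fun θ hθ ↦ (hasDerivAt_simplifiedCost (hcos θ hθ)).continuousAt.continuousWithinAt)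
    (fun θ hθ ↦ (hasDerivAt_simplifiedCost
      (hcos θ (interior_subset hθ))).hasDerivWithinAt) fun θ hθ ↦ ?_
  rw [interior_Ioo] at hθ
  have hc := hcos θ hθ
  have hs : 0 < sin θ := sin_pos_of_pos_of_lt_pi (by linarith [hθ.1, pi_pos])
    (by linarith [hθ.2, pi_pos])
  have hπ : 0 < 1 - θ / π := by
    rw [sub_pos, div_lt_one pi_pos]
    linarith [hθ.2, pi_pos]
  have hlt : cos θ < √2 / 2 := by
    rw [← cos_pi_div_four]
    exact cos_lt_cos_of_nonneg_of_le_pi_div_two (by positivity) hθ.2.le hθ.1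
  have hsq : cos θ ^ 2 < 1 / 2 := by
    nlinarith [sq_sqrt (show (0 : ℝ) ≤ 2 by norm_num)]
  have hinv : 2 < 1 / cos θ ^ 2 := by
    rw [lt_div_iff₀ (by positivity)]
    linarith
  have : 0 < (1 - θ / π) * (sin θ / cos θ ^ 2) := by positivity
  linarith

/-- The lower-bound cost function h is strictly increasing on [1.148, π/2); in particular
h(θ) ≥ h(1.148) there. -/
theorem stmt_11 (h : ℝ → ℝ)
    (hh : ∀ θ : ℝ, h θ = (1 / (2 * π)) * Real.log ((1 + Real.sin θ) / (1 - Real.sin θ))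
        + (1 - θ / π) * (1 / Real.cos θ
            + π * (Real.tan θ + π - 2 * θ + 3) / (4 * (π - θ)))) :
    StrictMonoOn h (Set.Ico (1.148 : ℝ) (π / 2)) ∧
    ∀ θ ∈ Set.Ico (1.148 : ℝ) (π / 2), h 1.148 ≤ h θ := by
  have hsub : Set.Ico (1.148 : ℝ) (π / 2) ⊆ Set.Ioo (π / 4) (π / 2) := fun θ hθ ↦
    ⟨by linarith [hθ.1, pi_lt_d2], hθ.2⟩
  have hmono : StrictMonoOn h (Set.Ico (1.148 : ℝ) (π / 2)) := by
    refine (simplifiedCost_strictMonoOn.mono hsub).congr fun θ hθ ↦ ?_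
    have hc : 0 < cos θ :=
      cos_pos_of_mem_Ioo ⟨by linarith [hθ.1, pi_pos], hθ.2⟩
    rw [hh, simplifiedCost_eq hc (by linarith [hθ.2, pi_pos])]
  exact ⟨hmono, fun θ hθ ↦ hmono.monotoneOn ⟨le_rfl, hθ.1.trans_lt hθ.2⟩ hθ hθ.1⟩
end

section
/- Define h(θ) = (1/(2π))·log((1 + sin θ)/(1 - sin θ)) + (1 - θ/π)·(1/cos θ + π·(tan θ + π - 2θ + 3)/(4(π - θ))). Then h(1.148) > 3.553. -/
open Real

lemma sin_le_sub_cube_add_pow_five {x : ℝ} (h₀ : 0 ≤ x) (h₁ : x ≤ 1) :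
    Real.sin x ≤ x - x ^ 3 / 6 + x ^ 5 / 100 := by
  have hx : |x| ≤ 1 := by rwa [abs_of_nonneg h₀]
  have h := Real.sin_bound hx
  rw [abs_of_nonneg h₀] at h
  linarith [(abs_le.mp h).2]

lemma cos_1148_le : Real.cos 1.148 ≤ 0.41034 := by
  have hmono : Real.sin (π / 2 - 1.148) ≤ Real.sin 0.4227965 :=
    sin_le_sin_of_le_of_le_pi_div_two (by linarith [pi_gt_d6]) (by linarith [pi_gt_d6])
      (by linarith [pi_lt_d6])
  rw [Real.sin_pi_div_two_sub] at hmono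
  have h := sin_le_sub_cube_add_pow_five (x := 0.4227965) (by norm_num) (by norm_num)
  norm_num at h hmono ⊢
  linarith

lemma cos_1148_pos : 0 < Real.cos 1.148 :=
  cos_pos_of_mem_Ioo ⟨by linarith [pi_gt_d6], by linarith [pi_gt_d6]⟩

lemma le_sin_1148 : 0.91193 ≤ Real.sin 1.148 := by
  have hs : 0 ≤ Real.sin 1.148 :=
    sin_nonneg_of_nonneg_of_le_pi (by norm_num) (by linarith [pi_gt_d6])
  nlinarith [Real.sin_sq_add_cos_sq 1.148, cos_1148_le, cos_1148_pos]

lemma le_log_217_div_10 : 3.077 ≤ Real.log 21.7 := by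
  have h := sum_range_le_log_div (x := 0.1511) (by norm_num) (by norm_num) 3
  have hle : Real.log (2 ^ 4 * ((1 + 0.1511) / (1 - 0.1511))) ≤ Real.log 21.7 :=
    Real.log_le_log (by norm_num) (by norm_num)
  rw [Real.log_mul (by norm_num) (by norm_num), Real.log_pow] at hle
  norm_num [Finset.sum_range_succ] at h hle ⊢
  linarith [log_two_gt_d9]

/-- Numerical bound: the lower-bound cost function h evaluated at θ = 1.148 exceeds
3.553. -/
theorem stmt_12 (h : ℝ → ℝ)
    (hh : ∀ θ : ℝ, h θ = (1 / (2 * π)) * Real.log ((1 + Real.sin θ) / (1 - Real.sin θ))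
        + (1 - θ / π) * (1 / Real.cos θ
            + π * (Real.tan θ + π - 2 * θ + 3) / (4 * (π - θ)))) :
    (3.553 : ℝ) < h 1.148 := by
  have hπ := pi_gt_d6
  have hπ' := pi_lt_d6
  have hπ0 := pi_pos
  have hc := cos_1148_pos
  have hc' := cos_1148_le
  have hs := le_sin_1148
  have hs1 : Real.sin 1.148 < 1 := by
    nlinarith [Real.sin_sq_add_cos_sq 1.148]
  have hlog : 3.077 ≤ Real.log ((1 + Real.sin 1.148) / (1 - Real.sin 1.148)) := by
    refine le_log_217_div_10.trans (Real.log_le_log (by norm_num) ?_)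
    rw [le_div_iff₀ (by linarith)]
    linarith
  have hsec : 2.437 ≤ 1 / Real.cos 1.148 := by
    rw [le_div_iff₀ hc]
    linarith
  have htan : 2.22237 ≤ Real.tan 1.148 := by
    rw [Real.tan_eq_sin_div_cos, le_div_iff₀ hc]
    linarith
  have hsplit : (1 - 1.148 / π) * (1 / Real.cos 1.148
      + π * (Real.tan 1.148 + π - 2 * 1.148 + 3) / (4 * (π - 1.148)))
      = (1 - 1.148 / π) * (1 / Real.cos 1.148)
        + (Real.tan 1.148 + π - 2 * 1.148 + 3) / 4 := by
    have : π - 1.148 ≠ 0 := by linarith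
    rw [mul_add]
    congr 1
    field_simp
  have hinv : 0.318309 ≤ 1 / π := by
    rw [le_div_iff₀ hπ0]
    linarith
  have hinv' : 1 / π ≤ 0.31831 := by
    rw [div_le_iff₀ hπ0]
    linarith
  have hlogterm : 0.48971 ≤
      (1 / (2 * π)) * Real.log ((1 + Real.sin 1.148) / (1 - Real.sin 1.148)) := by
    have : 1 / (2 * π) = 1 / π / 2 := by ring
    rw [this]
    nlinarith
  have hsecterm : 0.63458 * 2.437 ≤ (1 - 1.148 / π) * (1 / Real.cos 1.148) := by
    have : 0.63458 ≤ 1 - 1.148 / π := by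
      have : 1.148 / π = 1.148 * (1 / π) := by ring
      linarith
    exact mul_le_mul this hsec (by norm_num) (by linarith)
  rw [hh, hsplit]
  linarith
end

section
/- Let ψ : (0, 1] → ℝ be differentiable with ψ'(x) = -2π + cot(ψ(x))/x for all x ∈ (0, 1], and suppose ψ(x) → π/2 as x → 0⁺. Then there exist constants C > 0 and δ ∈ (0, 1] such that |ψ(x) - (π/2 - π·x)| ≤ C·x² for all x ∈ (0, δ). -/
open Real

/-- A function on `(0, δ)` with nonnegative derivative and right limit `0` at `0` is nonnegative. -/
theorem nonneg_of_hasDerivAt_nonneg_of_tendsto_zero {f f' : ℝ → ℝ} {δ : ℝ}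
    (hf : ∀ x ∈ Set.Ioo 0 δ, HasDerivAt f (f' x) x) (hf' : ∀ x ∈ Set.Ioo 0 δ, 0 ≤ f' x)
    (h0 : Filter.Tendsto f (nhdsWithin 0 (Set.Ioi 0)) (nhds 0)) :
    ∀ x ∈ Set.Ioo 0 δ, 0 ≤ f x := by
  have hmono : MonotoneOn f (Set.Ioo 0 δ) := by
    refine monotoneOn_of_deriv_nonneg (convex_Ioo 0 δ)
      (fun x hx => (hf x hx).continuousAt.continuousWithinAt) ?_ ?_
    · rw [interior_Ioo]
      exact fun x hx => (hf x hx).differentiableAt.differentiableWithinAt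
    · rw [interior_Ioo]
      intro x hx
      rw [(hf x hx).deriv]
      exact hf' x hx
  intro x hx
  refine le_of_tendsto h0 ?_
  filter_upwards [Ioo_mem_nhdsGT hx.1] with y hy
  exact hmono ⟨hy.1, hy.2.trans hx.2⟩ hx hy.2.le

/-- For `|u| ≤ 1`, the sine differs from its argument by at most `u ^ 2 / 2`. -/
theorem abs_sin_sub_self_le {u : ℝ} (hu : |u| ≤ 1) : |sin u - u| ≤ u ^ 2 / 2 := by
  have h := Real.sin_bound hu
  have h3 : |u| ^ 3 ≤ |u| ^ 2 := pow_le_pow_of_le_one (abs_nonneg u) hu (by norm_num)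
  have h5 : |u| ^ 5 ≤ |u| ^ 2 := pow_le_pow_of_le_one (abs_nonneg u) hu (by norm_num)
  have h2 := sq_nonneg u
  rw [← abs_pow u 3] at h3
  rw [sq_abs] at h3 h5
  rw [abs_le] at h h3 ⊢
  constructor <;> linarith [h.1, h.2, h3.1, h3.2]

/-- Asymptotic expansion ψ(x) = π/2 - πx + O(x²) near the singular initial point of the
ODE ψ'(x) = -2π + cot(ψ(x))/x with ψ(0⁺) = π/2. -/
theorem stmt_16 (ψ : ℝ → ℝ)
    (hderiv : ∀ x ∈ Set.Ioc (0 : ℝ) 1,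
        HasDerivAt ψ (-2 * π + Real.cot (ψ x) / x) x)
    (hlim : Filter.Tendsto ψ (nhdsWithin 0 (Set.Ioi 0)) (nhds (π / 2))) :
    ∃ C > (0 : ℝ), ∃ δ ∈ Set.Ioc (0 : ℝ) 1,
      ∀ x ∈ Set.Ioo (0 : ℝ) δ, |ψ x - (π / 2 - π * x)| ≤ C * x ^ 2 := by
  have hπ := Real.pi_pos
  obtain ⟨δ, hδ, hclose⟩ : ∃ δ ∈ Set.Ioc (0 : ℝ) 1, ∀ x ∈ Set.Ioo 0 δ, |π / 2 - ψ x| ≤ 1 := by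
    have h := hlim (Metric.ball_mem_nhds (π / 2) one_pos)
    obtain ⟨δ, hδ, hsub⟩ := mem_nhdsGT_iff_exists_Ioo_subset.1 h
    refine ⟨min δ 1, ⟨lt_min hδ one_pos, min_le_right _ _⟩, fun x hx => ?_⟩
    have hx' := hsub ⟨hx.1, hx.2.trans_le (min_le_left _ _)⟩
    rw [Set.mem_preimage, Metric.mem_ball, dist_comm, Real.dist_eq] at hx'
    exact hx'.le
  have hsin : ∀ x ∈ Set.Ioo 0 δ, 0 < sin (ψ x) := fun x hx => by
    rw [← Real.cos_pi_div_two_sub]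
    exact Real.cos_pos_of_le_one (hclose x hx)
  -- The substitution `x * cos (ψ x)` removes the singular term.
  have hs : ∀ x ∈ Set.Ioo 0 δ,
      HasDerivAt (fun x => x * cos (ψ x)) (2 * π * x * sin (ψ x)) x := fun x hx => by
    refine ((hasDerivAt_id x).mul (hderiv x ⟨hx.1, hx.2.le.trans hδ.2⟩).cos).congr_deriv ?_
    have h1 := (hsin x hx).ne'
    have h2 := hx.1.ne'
    simp only [id, Real.cot_eq_cos_div_sin]
    field_simp
    ring
  have hid : Filter.Tendsto (fun x : ℝ => x) (nhdsWithin 0 (Set.Ioi 0)) (nhds 0) :=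
    tendsto_nhdsWithin_of_tendsto_nhds Filter.tendsto_id
  have hs0 : Filter.Tendsto (fun x => x * cos (ψ x)) (nhdsWithin 0 (Set.Ioi 0)) (nhds 0) := by
    simpa using hid.mul ((Real.continuous_cos.tendsto _).comp hlim)
  have hpow (c : ℝ) (n : ℕ) : Filter.Tendsto (fun x : ℝ => c * x ^ (n + 1))
      (nhdsWithin 0 (Set.Ioi 0)) (nhds 0) := by
    simpa using (hid.pow (n + 1)).const_mul c
  have hpow' (c : ℝ) (n : ℕ) (x : ℝ) :
      HasDerivAt (fun x : ℝ => c * x ^ (n + 1)) (c * ((n + 1) * x ^ n)) x := by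
    simpa using (hasDerivAt_pow (n + 1) x).const_mul c
  have hcos_nonneg : ∀ x ∈ Set.Ioo 0 δ, 0 ≤ cos (ψ x) := fun x hx => by
    have h := nonneg_of_hasDerivAt_nonneg_of_tendsto_zero hs
      (fun y hy => mul_nonneg (by have := hy.1; positivity) (hsin y hy).le) hs0 x hx
    exact nonneg_of_mul_nonneg_right h hx.1
  have hcos_le : ∀ x ∈ Set.Ioo 0 δ, cos (ψ x) ≤ π * x := fun x hx => by
    have h := nonneg_of_hasDerivAt_nonneg_of_tendsto_zero
      (fun y hy => (hpow' π 1 y).sub (hs y hy))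
      (fun y hy => by
        have h1 := mul_nonneg (mul_nonneg hπ.le hy.1.le) (sub_nonneg.2 (Real.sin_le_one (ψ y)))
        push_cast
        nlinarith)
      (by
        have h0 := (hpow π 1).sub hs0
        rwa [sub_zero] at h0) x hx
    have h' : 0 ≤ x * (π * x - cos (ψ x)) := by
      convert h using 1
      simp only [Pi.sub_apply]
      ring
    exact sub_nonneg.1 (nonneg_of_mul_nonneg_right h' hx.1)
  have hcos_ge : ∀ x ∈ Set.Ioo 0 δ, π * x - π ^ 3 / 2 * x ^ 3 ≤ cos (ψ x) := fun x hx => by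
    have h := nonneg_of_hasDerivAt_nonneg_of_tendsto_zero
      (fun y hy => ((hs y hy).sub (hpow' π 1 y)).add (hpow' (π ^ 3 / 2) 3 y))
      (fun y hy => by
        have h1 : 1 - sin (ψ y) ≤ π ^ 2 * y ^ 2 := by
          have h2 := Real.sin_sq_add_cos_sq (ψ y)
          have h3 := mul_nonneg (hsin y hy).le (sub_nonneg.2 (Real.sin_le_one (ψ y)))
          have h4 := pow_le_pow_left₀ (hcos_nonneg y hy) (hcos_le y hy) 2
          nlinarith
        have h5 := mul_nonneg (mul_nonneg hπ.le hy.1.le) (sub_nonneg.2 h1)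
        push_cast
        nlinarith)
      (by
        have h0 := (hs0.sub (hpow π 1)).add (hpow (π ^ 3 / 2) 3)
        rwa [sub_zero, add_zero] at h0) x hx
    have h' : 0 ≤ x * (cos (ψ x) - (π * x - π ^ 3 / 2 * x ^ 3)) := by
      convert h using 1
      simp only [Pi.sub_apply, Pi.add_apply]
      ring
    exact sub_nonneg.1 (nonneg_of_mul_nonneg_right h' hx.1)
  refine ⟨2 * π ^ 2 + π ^ 3, by positivity, δ, hδ, fun x hx => ?_⟩
  have hx0 := hx.1
  have hu := hclose x hx
  have hsub := abs_sin_sub_self_le hu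
  have h1 := hcos_nonneg x hx
  have h2 := hcos_le x hx
  have h3 := hcos_ge x hx
  rw [← Real.sin_pi_div_two_sub] at h1 h2 h3
  set u := π / 2 - ψ x with hu_def
  have hψ : ψ x - (π / 2 - π * x) = π * x - u := by rw [hu_def]; ring
  have husq : u ^ 2 ≤ |u| := by
    rw [← sq_abs]
    nlinarith [abs_nonneg u]
  have hu_le : |u| ≤ 2 * π * x := by
    have h4 := abs_sub_abs_le_abs_sub u (sin u)
    rw [abs_sub_comm u (sin u), abs_of_nonneg h1] at h4
    linarith
  have hu2 : u ^ 2 ≤ 4 * π ^ 2 * x ^ 2 := by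
    rw [← sq_abs]
    exact (pow_le_pow_left₀ (abs_nonneg u) hu_le 2).trans_eq (by ring)
  have hx3 : π ^ 3 * x ^ 3 ≤ π ^ 3 * x ^ 2 :=
    mul_le_mul_of_nonneg_left
      (pow_le_pow_of_le_one hx0.le (hx.2.le.trans hδ.2) (by norm_num)) (by positivity)
  have hpos : 0 ≤ π ^ 3 * x ^ 2 := by positivity
  rw [abs_le] at hsub
  rw [hψ, abs_le]
  constructor <;> linarith [hsub.1, hsub.2]
end

section
/- Let ψ : (0, 1] → ℝ be differentiable with ψ'(x) = -2π + cot(ψ(x))/x for all x ∈ (0, 1] and ψ(x) → π/2 as x → 0⁺, and let τ : (0, 1] → ℝ be differentiable with τ'(x) = 2π·(τ(x)·cot(ψ(x)) - 1) for all x ∈ (0, 1] and τ(x) → τ₀ as x → 0⁺ for some real τ₀. Then there exist constants C > 0 and δ ∈ (0, 1] such that |τ(x) - (τ₀ - 2π·x)| ≤ C·x² for all x ∈ (0, δ). -/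
open Real

/-- If `f' ≤ 2 B x` on `(0, δ)` and `f → L` at `0⁺`, then `f x - L ≤ B x ^ 2` on `(0, δ)`. -/
lemma sub_le_mul_sq_of_deriv_le {f f' : ℝ → ℝ} {L B δ : ℝ}
    (hf : ∀ x ∈ Set.Ioo 0 δ, HasDerivAt f (f' x) x)
    (hb : ∀ x ∈ Set.Ioo 0 δ, f' x ≤ 2 * B * x)
    (hL : Filter.Tendsto f (nhdsWithin 0 (Set.Ioi 0)) (nhds L)) :
    ∀ x ∈ Set.Ioo 0 δ, f x - L ≤ B * x ^ 2 := by
  have hg : ∀ x ∈ Set.Ioo 0 δ,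
      HasDerivAt (fun y => f y - B * y ^ 2) (f' x - 2 * B * x) x := fun x hx => by
    refine ((hf x hx).sub (((hasDerivAt_id x).pow 2).const_mul B)).congr_deriv ?_
    simp
    ring
  have hanti : AntitoneOn (fun y => f y - B * y ^ 2) (Set.Ioo 0 δ) := by
    refine antitoneOn_of_deriv_nonpos (convex_Ioo 0 δ)
      (fun x hx => (hg x hx).continuousAt.continuousWithinAt)
      (fun x hx => (hg x (interior_subset hx)).differentiableAt.differentiableWithinAt)
      (fun x hx => ?_)
    have hx := interior_subset hx
    rw [(hg x hx).deriv]
    linarith [hb x hx]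
  intro x hx
  have hlim : Filter.Tendsto (fun y => f y - B * y ^ 2) (nhdsWithin 0 (Set.Ioi 0)) (nhds L) := by
    have hc : Filter.Tendsto (fun y : ℝ => B * y ^ 2) (nhdsWithin 0 (Set.Ioi 0)) (nhds 0) := by
      have : Continuous fun y : ℝ => B * y ^ 2 := by fun_prop
      simpa using (this.tendsto 0).mono_left nhdsWithin_le_nhds
    simpa using hL.sub hc
  have hle : f x - B * x ^ 2 ≤ L := by
    refine ge_of_tendsto hlim ?_
    filter_upwards [Ioo_mem_nhdsGT hx.1] with y hy
    exact hanti ⟨hy.1, hy.2.trans hx.2⟩ hx hy.2.le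
  linarith

/-- If `|f'| ≤ 2 B x` on `(0, δ)` and `f → L` at `0⁺`, then `|f x - L| ≤ B x ^ 2` on `(0, δ)`. -/
lemma abs_sub_le_mul_sq_of_abs_deriv_le {f f' : ℝ → ℝ} {L B δ : ℝ}
    (hf : ∀ x ∈ Set.Ioo 0 δ, HasDerivAt f (f' x) x)
    (hb : ∀ x ∈ Set.Ioo 0 δ, |f' x| ≤ 2 * B * x)
    (hL : Filter.Tendsto f (nhdsWithin 0 (Set.Ioi 0)) (nhds L)) :
    ∀ x ∈ Set.Ioo 0 δ, |f x - L| ≤ B * x ^ 2 := by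
  intro x hx
  have h₁ := sub_le_mul_sq_of_deriv_le hf (fun y hy => (abs_le.1 (hb y hy)).2) hL x hx
  have h₂ := sub_le_mul_sq_of_deriv_le (f := fun y => -f y) (f' := fun y => -f' y) (B := B)
    (fun y hy => (hf y hy).neg) (fun y hy => by linarith [(abs_le.1 (hb y hy)).1]) hL.neg x hx
  exact abs_le.2 ⟨by linarith, h₁⟩

/-- Asymptotic expansion τ(x) = τ₀ - 2πx + O(x²) near the singular initial point of the
ODE system Sys(τ₀). -/
theorem stmt_17 (ψ τ : ℝ → ℝ) (τ₀ : ℝ)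
    (hψderiv : ∀ x ∈ Set.Ioc (0 : ℝ) 1,
        HasDerivAt ψ (-2 * π + Real.cot (ψ x) / x) x)
    (hψlim : Filter.Tendsto ψ (nhdsWithin 0 (Set.Ioi 0)) (nhds (π / 2)))
    (hτderiv : ∀ x ∈ Set.Ioc (0 : ℝ) 1,
        HasDerivAt τ (2 * π * (τ x * Real.cot (ψ x) - 1)) x)
    (hτlim : Filter.Tendsto τ (nhdsWithin 0 (Set.Ioi 0)) (nhds τ₀)) :
    ∃ C > (0 : ℝ), ∃ δ ∈ Set.Ioc (0 : ℝ) 1,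
      ∀ x ∈ Set.Ioo (0 : ℝ) δ, |τ x - (τ₀ - 2 * π * x)| ≤ C * x ^ 2 := by
  have hid : Filter.Tendsto (fun x : ℝ => x) (nhdsWithin 0 (Set.Ioi 0)) (nhds 0) :=
    nhdsWithin_le_nhds
  have hsin : ∀ᶠ x in nhdsWithin 0 (Set.Ioi 0), 1 / 2 < sin (ψ x) := by
    have h := (continuous_sin.tendsto _).comp hψlim
    rw [sin_pi_div_two] at h
    exact h.eventually (lt_mem_nhds (by norm_num))
  have hτb : ∀ᶠ x in nhdsWithin 0 (Set.Ioi 0), |τ x| < |τ₀| + 1 :=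
    hτlim.abs.eventually (gt_mem_nhds (by linarith))
  obtain ⟨ε, hε, hεs⟩ := mem_nhdsGT_iff_exists_Ioo_subset.1 (hsin.and hτb)
  have hε : 0 < ε := hε
  set M := |τ₀| + 1
  have hM0 : 0 < M := by positivity
  refine ⟨2 * π ^ 2 * M, by positivity, min ε 1, ⟨lt_min hε one_pos, min_le_right _ _⟩, ?_⟩
  have hmem : ∀ x ∈ Set.Ioo 0 (min ε 1),
      x ∈ Set.Ioc (0 : ℝ) 1 ∧ 1 / 2 < sin (ψ x) ∧ |τ x| < M := fun x hx =>
    ⟨⟨hx.1, (hx.2.trans_le (min_le_right _ _)).le⟩,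
      hεs ⟨hx.1, hx.2.trans_le (min_le_left _ _)⟩⟩
  have hcos : ∀ x ∈ Set.Ioo 0 (min ε 1), |x * cos (ψ x) - 0| ≤ π * x ^ 2 := by
    refine abs_sub_le_mul_sq_of_abs_deriv_le (f' := fun x => 2 * π * x * sin (ψ x)) ?_ ?_ ?_
    · intro x hx
      obtain ⟨hx1, hs, -⟩ := hmem x hx
      have hx0 : x ≠ 0 := hx.1.ne'
      have hs0 : sin (ψ x) ≠ 0 := by linarith
      refine ((hasDerivAt_id x).mul (hψderiv x hx1).cos).congr_deriv ?_
      rw [Real.cot_eq_cos_div_sin]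
      simp only [id]
      field_simp
      ring
    · intro x hx
      have hx0 := hx.1
      rw [abs_mul, abs_of_pos (by positivity)]
      exact mul_le_of_le_one_right (by positivity) (abs_sin_le_one _)
    · simpa using hid.mul ((continuous_cos.tendsto _).comp hψlim)
  have hcot : ∀ x ∈ Set.Ioo 0 (min ε 1), |Real.cot (ψ x)| ≤ 2 * π * x := by
    intro x hx
    obtain ⟨-, hs, -⟩ := hmem x hx
    have hx0 := hx.1
    have h := hcos x hx
    rw [sub_zero, abs_mul, abs_of_pos hx0] at h
    have hc : |cos (ψ x)| ≤ π * x := le_of_mul_le_mul_left (by linarith) hx0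
    rw [Real.cot_eq_cos_div_sin, abs_div, abs_of_pos (by linarith : 0 < sin (ψ x)),
      div_le_iff₀ (by linarith)]
    have : 0 < π * x := by positivity
    nlinarith
  intro x hx
  have key := abs_sub_le_mul_sq_of_abs_deriv_le (f := fun x => τ x + 2 * π * x)
    (f' := fun x => 2 * π * (τ x * Real.cot (ψ x))) (L := τ₀) (B := 2 * π ^ 2 * M)
    (δ := min ε 1) ?_ ?_ ?_ x hx
  · convert key using 2
    ring
  · intro y hy
    refine ((hτderiv y (hmem y hy).1).add
      ((hasDerivAt_id y).const_mul (2 * π))).congr_deriv ?_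
    ring
  · intro y hy
    have hy0 := hy.1
    rw [abs_mul, abs_of_pos two_pi_pos, abs_mul]
    calc 2 * π * (|τ y| * |Real.cot (ψ y)|) ≤ 2 * π * (M * (2 * π * y)) := by
          gcongr
          · exact (hmem y hy).2.2.le
          · exact hcot y hy
      _ = 2 * (2 * π ^ 2 * M) * y := by ring
  · simpa using hτlim.add (hid.const_mul (2 * π))
end

section
/- Let ξ ∈ (0, 1] and let ψ : [0, ξ] → ℝ be continuous on [0, ξ], differentiable on (0, ξ], with ψ(0) = π/2, ψ(x) ∈ (0, π) for all x ∈ [0, ξ], and ψ'(x) = -2π + cot(ψ(x))/x for all x ∈ (0, ξ]. Then ψ(x) ≥ arctan(1/(2πξ)) for all x ∈ [0, ξ]; in particular sin(ψ(x)) is bounded below on [0, ξ] by the positive constant sin(arctan(1/(2πξ))). -/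
open Real

/-- At a minimum over `[0, b]` attained at a positive point, the derivative is nonpositive. -/
lemma IsMinOn.derivWithin_Icc_nonpos {f : ℝ → ℝ} {b x d : ℝ} (hmin : IsMinOn f (Set.Icc 0 b) x)
    (hx : x ∈ Set.Ioc 0 b) (hf : HasDerivWithinAt f d (Set.Icc 0 b) x) : d ≤ 0 := by
  have hseg : segment ℝ x 0 ⊆ Set.Icc 0 b :=
    (convex_Icc 0 b).segment_subset ⟨hx.1.le, hx.2⟩ ⟨le_rfl, hx.1.le.trans hx.2⟩
  have h := hmin.localize.hasFDerivWithinAt_nonneg hf.hasFDerivWithinAt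
    (sub_mem_posTangentConeAt_of_segment_subset hseg)
  have h' : 0 ≤ -x * d := by simpa using h
  by_contra! hd
  nlinarith [mul_pos hx.1 hd]

lemma lt_cot_of_lt_arctan {y c : ℝ} (hc : 0 < c) (hy : 0 < y) (h : y < arctan (1 / c)) :
    c < Real.cot y := by
  have hlt : y < π / 2 := h.trans (arctan_lt_pi_div_two _)
  have htan : tan y < 1 / c := by
    simpa only [tan_arctan] using
      tan_lt_tan_of_nonneg_of_lt_pi_div_two hy.le (arctan_lt_pi_div_two _) h
  have hpos : 0 < tan y := tan_pos_of_pos_of_lt_pi_div_two hy hlt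
  rw [← Real.tan_inv_eq_cot, ← one_div]
  exact (lt_one_div hpos hc).1 htan

lemma cot_nonpos_of_pi_div_two_le {y : ℝ} (h : π / 2 ≤ y) (h' : y ≤ π) : Real.cot y ≤ 0 := by
  rw [Real.cot_eq_cos_div_sin]
  exact div_nonpos_of_nonpos_of_nonneg
    (cos_nonpos_of_pi_div_two_le_of_le h (by linarith [pi_pos]))
    (sin_nonneg_of_nonneg_of_le_pi (by linarith [pi_pos]) h')

/-- Lower bound for the refraction angle: a solution ψ of ψ' = -2π + cot(ψ)/x on (0, ξ]
with ψ(0) = π/2 and values in (0, π) satisfies ψ(x) ≥ arctan(1/(2πξ)); in particular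
sin(ψ(x)) is bounded below by the positive constant sin(arctan(1/(2πξ))). -/
theorem stmt_18 (ξ : ℝ) (hξ : ξ ∈ Set.Ioc (0 : ℝ) 1) (ψ : ℝ → ℝ)
    (hcont : ContinuousOn ψ (Set.Icc 0 ξ))
    (h0 : ψ 0 = π / 2)
    (hrange : ∀ x ∈ Set.Icc 0 ξ, ψ x ∈ Set.Ioo 0 π)
    (hderiv : ∀ x ∈ Set.Ioc (0 : ℝ) ξ,
        HasDerivWithinAt ψ (-2 * π + Real.cot (ψ x) / x) (Set.Icc 0 ξ) x) :
    (∀ x ∈ Set.Icc 0 ξ, Real.arctan (1 / (2 * π * ξ)) ≤ ψ x) ∧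
    (0 < Real.sin (Real.arctan (1 / (2 * π * ξ))) ∧
      ∀ x ∈ Set.Icc 0 ξ, Real.sin (Real.arctan (1 / (2 * π * ξ))) ≤ Real.sin (ψ x)) := by
  have hpos : 0 < 2 * π * ξ := mul_pos two_pi_pos hξ.1
  have hne : (Set.Icc 0 ξ).Nonempty := Set.nonempty_Icc.2 hξ.1.le
  have hlower : ∀ x ∈ Set.Icc 0 ξ, arctan (1 / (2 * π * ξ)) ≤ ψ x := by
    obtain ⟨x₀, hx₀, hmin⟩ := isCompact_Icc.exists_isMinOn hne hcont
    suffices h : arctan (1 / (2 * π * ξ)) ≤ ψ x₀ from fun x hx => h.trans (hmin hx)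
    by_contra! hlt
    have hx₀pos : 0 < x₀ := by
      refine hx₀.1.lt_of_ne ?_
      rintro rfl
      linarith [arctan_lt_pi_div_two (1 / (2 * π * ξ))]
    have hd := hmin.derivWithin_Icc_nonpos ⟨hx₀pos, hx₀.2⟩ (hderiv x₀ ⟨hx₀pos, hx₀.2⟩)
    have hcot := lt_cot_of_lt_arctan hpos (hrange x₀ hx₀).1 hlt
    have hle : Real.cot (ψ x₀) ≤ 2 * π * x₀ := (div_le_iff₀ hx₀pos).1 (by linarith)
    linarith [mul_le_mul_of_nonneg_left hx₀.2 two_pi_pos.le]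
  have hupper : ∀ x ∈ Set.Icc 0 ξ, ψ x ≤ π / 2 := by
    obtain ⟨x₀, hx₀, hmax⟩ := isCompact_Icc.exists_isMaxOn hne hcont
    suffices h : ψ x₀ ≤ π / 2 from fun x hx => le_trans (hmax hx) h
    by_contra! hlt
    have hx₀pos : 0 < x₀ := by
      refine hx₀.1.lt_of_ne ?_
      rintro rfl
      linarith
    have hd := hmax.neg.derivWithin_Icc_nonpos ⟨hx₀pos, hx₀.2⟩
      (hderiv x₀ ⟨hx₀pos, hx₀.2⟩).fun_neg
    have hcot := div_nonpos_of_nonpos_of_nonneg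
      (cot_nonpos_of_pi_div_two_le hlt.le (hrange x₀ hx₀).2.le) hx₀pos.le
    linarith [pi_pos]
  have harctan : 0 < arctan (1 / (2 * π * ξ)) := arctan_pos.2 (one_div_pos.2 hpos)
  refine ⟨hlower, sin_pos_of_pos_of_lt_pi harctan ?_, fun x hx => ?_⟩
  · linarith [arctan_lt_pi_div_two (1 / (2 * π * ξ)), pi_pos]
  · exact sin_le_sin_of_le_of_le_pi_div_two (by linarith [pi_pos]) (hupper x hx) (hlower x hx)
end
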